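/- Let K be a compact Hausdorff space, f : K → ℝ bounded and universally measurable, and f̃ : M¹(K) → ℝ defined by f̃(μ) = ∫ f dμ. Then: (a) for every countable ordinal α ≥ 1, f ∈ Hf_α(K) if and only if f̃ ∈ Hf_α(M¹(K)); (b) for every countable ordinal α ≥ 1, f ∈ Bof_α(K) if and only if f̃ ∈ Bof_α(M¹(K)); (c) for every countable ordinal α ≥ 0, f ∈ C_α(K) if and only if f̃ ∈ C_α(M¹(K)). -/

import Mathlib

open MeasureTheory Filter Topology Set

noncomputable section

/-- The first uncountable ordinal `ω₁`. -/
def omega1 : Ordinal.{0} := (Cardinal.aleph 1).ord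

/-- A subset `A` of a topological space is *resolvable* (an `H`-set) if every nonempty
subset `B` has a nonempty relatively open piece entirely inside `A` or disjoint from `A`. -/
def Resolvable {X : Type*} [TopologicalSpace X] (A : Set X) : Prop :=
  ∀ B : Set X, B.Nonempty →
    ∃ U : Set X, IsOpen U ∧ (B ∩ U).Nonempty ∧ (B ∩ U ⊆ A ∨ B ∩ U ∩ A = ∅)

/-- The algebra of sets generated by a collection `G`. -/
inductive AlgGen {X : Type*} (G : Set X → Prop) : Set X → Prop
  | basic (s : Set X) : G s → AlgGen G s
  | empty : AlgGen G ∅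
  | compl (s : Set X) : AlgGen G s → AlgGen G sᶜ
  | union (s t : Set X) : AlgGen G s → AlgGen G t → AlgGen G (s ∪ t)

/-- `Bos X` : the algebra of sets generated by the open subsets of `X`. -/
def Bos (X : Type*) [TopologicalSpace X] : Set X → Prop :=
  AlgGen fun s : Set X => IsOpen s

/-- `Hs X` : the algebra of sets generated by the resolvable subsets of `X`. -/
def Hs (X : Type*) [TopologicalSpace X] : Set X → Prop :=
  AlgGen fun s : Set X => Resolvable s

/-- `Σ₂(F)` : countable unions of members of the family `F`. -/
def SigmaTwo {X : Type*} (F : Set X → Prop) (s : Set X) : Prop :=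
  ∃ g : ℕ → Set X, (∀ n, F (g n)) ∧ s = ⋃ n, g n

/-- `Σ₂(F)`-measurability of a function: preimages of open sets lie in `Σ₂(F)`. -/
def SigmaTwoMeasurable {X Y : Type*} [TopologicalSpace Y] (F : Set X → Prop)
    (f : X → Y) : Prop :=
  ∀ U : Set Y, IsOpen U → SigmaTwo F (f ⁻¹' U)

/-- The hierarchy of functions obtained from the class `F0` (put at level `1`) by
iterated pointwise limits of sequences. -/
inductive FunHier {X Y : Type*} [TopologicalSpace Y] (F0 : (X → Y) → Prop) :
    Ordinal.{0} → (X → Y) → Prop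
  | base (f : X → Y) : F0 f → FunHier F0 1 f
  | lim (α : Ordinal.{0}) (β : ℕ → Ordinal.{0}) (g : ℕ → X → Y) (f : X → Y) :
      (∀ n, 1 ≤ β n) → (∀ n, β n < α) → (∀ n, FunHier F0 (β n) (g n)) →
      (∀ x, Tendsto (fun n => g n x) atTop (𝓝 (f x))) → FunHier F0 α f

/-- The classes `Hf_α(X)` of resolvably measurable functions, `1 ≤ α < ω₁`. -/
def HfClass (X : Type*) [TopologicalSpace X] {Y : Type*} [TopologicalSpace Y]
    (α : Ordinal.{0}) (f : X → Y) : Prop :=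
  FunHier (SigmaTwoMeasurable (Hs X)) α f

/-- The classes `Bof_α(X)` of Borel measurable functions, `1 ≤ α < ω₁`. -/
def BofClass (X : Type*) [TopologicalSpace X] {Y : Type*} [TopologicalSpace Y]
    (α : Ordinal.{0}) (f : X → Y) : Prop :=
  FunHier (SigmaTwoMeasurable (Bos X)) α f

/-- The Baire classes: `C_0(X)` consists of the continuous functions and, for `α ≥ 1`,
`C_α(X)` consists of the pointwise limits of sequences of functions of lower classes. -/
inductive BaireClass (X : Type*) [TopologicalSpace X] (Y : Type*) [TopologicalSpace Y] :
    Ordinal.{0} → (X → Y) → Prop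
  | base (f : X → Y) : Continuous f → BaireClass X Y 0 f
  | lim (α : Ordinal.{0}) (β : ℕ → Ordinal.{0}) (g : ℕ → X → Y) (f : X → Y) :
      (∀ n, β n < α) → (∀ n, BaireClass X Y (β n) (g n)) →
      (∀ x, Tendsto (fun n => g n x) atTop (𝓝 (f x))) → BaireClass X Y α f

/-- The space `M¹(K)` of Radon probability measures on `K`, equipped with the weak*
topology (the topology of weak convergence of probability measures). -/
def RadonProb (K : Type*) [TopologicalSpace K] [MeasurableSpace K] [OpensMeasurableSpace K] :
    Type _ :=
  {μ : ProbabilityMeasure K // μ.toMeasure.InnerRegular}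

instance (K : Type*) [TopologicalSpace K] [MeasurableSpace K] [OpensMeasurableSpace K] :
    TopologicalSpace (RadonProb K) :=
  inferInstanceAs (TopologicalSpace {μ : ProbabilityMeasure K // μ.toMeasure.InnerRegular})

/-- The underlying measure of an element of `M¹(K)`. -/
def RadonProb.measure {K : Type*} [TopologicalSpace K] [MeasurableSpace K]
    [OpensMeasurableSpace K] (μ : RadonProb K) : Measure K :=
  (Subtype.val μ : ProbabilityMeasure K).toMeasure

/-- A universally measurable set: measurable with respect to every Radon probability
measure. -/
def UnivMeasurableSet {K : Type*} [TopologicalSpace K] [MeasurableSpace K] (H : Set K) : Prop :=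
  ∀ μ : ProbabilityMeasure K, μ.toMeasure.InnerRegular → NullMeasurableSet H μ.toMeasure

/-- A universally measurable function: measurable with respect to every Radon
probability measure. -/
def UnivMeasurableFn {K : Type*} [TopologicalSpace K] [MeasurableSpace K] (f : K → ℝ) : Prop :=
  ∀ μ : ProbabilityMeasure K, μ.toMeasure.InnerRegular → AEMeasurable f μ.toMeasure

/-! ### Generic facts on algebras and `Σ₂` -/

section Generic

variable {X : Type*} {G : Set X → Prop}

lemma AlgGen.univ : AlgGen G (Set.univ : Set X) := by
  simpa using AlgGen.compl _ (AlgGen.empty (G := G))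

lemma AlgGen.inter {s t : Set X} (hs : AlgGen G s) (ht : AlgGen G t) : AlgGen G (s ∩ t) := by
  have := AlgGen.compl _ (AlgGen.union _ _ (AlgGen.compl _ hs) (AlgGen.compl _ ht))
  simpa [Set.compl_union] using this

lemma SigmaTwo.of_mem {F : Set X → Prop} {s : Set X} (hs : F s) : SigmaTwo F s :=
  ⟨fun _ => s, fun _ => hs, by simp [Set.iUnion_const]⟩

lemma SigmaTwo.iUnion {F : Set X → Prop} {ι : Type*} [Countable ι] [Nonempty ι] {s : ι → Set X}
    (hs : ∀ i, SigmaTwo F (s i)) : SigmaTwo F (⋃ i, s i) := by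
  choose g hg hg' using hs
  obtain ⟨e, he⟩ := exists_surjective_nat (ι × ℕ)
  refine ⟨fun n => g (e n).1 (e n).2, fun n => hg _ _, ?_⟩
  rw [he.iUnion_comp (fun p : ι × ℕ => g p.1 p.2), Set.iUnion_prod']
  exact Set.iUnion_congr hg'

lemma SigmaTwo.inter {s t : Set X} (hs : SigmaTwo (AlgGen G) s) (ht : SigmaTwo (AlgGen G) t) :
    SigmaTwo (AlgGen G) (s ∩ t) := by
  obtain ⟨a, ha, rfl⟩ := hs
  obtain ⟨b, hb, rfl⟩ := ht
  rw [Set.iUnion_inter_iUnion]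
  exact SigmaTwo.iUnion fun i => SigmaTwo.iUnion fun j => SigmaTwo.of_mem ((ha i).inter (hb j))

/-- Superlevel sets are in `Σ₂`. -/
def Lo (F : Set X → Prop) (g : X → ℝ) : Prop := ∀ c : ℝ, SigmaTwo F {x | c < g x}

lemma Lo.const (a : ℝ) : Lo (AlgGen G) (fun _ : X => a) := by
  intro c
  by_cases h : c < a
  · simpa [h] using SigmaTwo.of_mem (AlgGen.univ (G := G))
  · simpa [h] using SigmaTwo.of_mem (AlgGen.empty (G := G))

lemma Lo.add {f g : X → ℝ} (hf : Lo (AlgGen G) f) (hg : Lo (AlgGen G) g) :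
    Lo (AlgGen G) (fun x => f x + g x) := by
  intro c
  have : {x | c < f x + g x} = ⋃ q : ℚ, ({x | (q : ℝ) < f x} ∩ {x | c - q < g x}) := by
    ext x
    simp only [Set.mem_ofPred_eq, Set.mem_iUnion, Set.mem_inter_iff]
    constructor
    · intro h
      obtain ⟨q, h1, h2⟩ := exists_rat_btwn (show c - g x < f x by linarith)
      exact ⟨q, h2, by linarith⟩
    · rintro ⟨q, h1, h2⟩
      linarith
  rw [this]
  exact SigmaTwo.iUnion fun q => (hf _).inter (hg _)

lemma Lo.const_mul {f : X → ℝ} (hf : Lo (AlgGen G) f) {a : ℝ} (ha : 0 ≤ a) :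
    Lo (AlgGen G) (fun x => a * f x) := by
  rcases ha.eq_or_lt with rfl | ha
  · simpa using Lo.const (G := G) (0 : ℝ)
  · intro c
    have : {x | c < a * f x} = {x | c / a < f x} := by
      ext x; simp [div_lt_iff₀ ha, mul_comm]
    rw [this]; exact hf _

lemma Lo.sum {ι : Type*} (s : Finset ι) {f : ι → X → ℝ} (hf : ∀ i ∈ s, Lo (AlgGen G) (f i)) :
    Lo (AlgGen G) (fun x => ∑ i ∈ s, f i x) := by
  classical
  induction s using Finset.induction_on with
  | empty => simpa using Lo.const (G := G) (0 : ℝ)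
  | insert a s ha ih =>
    simp only [Finset.sum_insert ha]
    exact (hf a (by simp)).add (ih fun i hi => hf i (by simp [hi]))

lemma Lo.of_sup {F : Set X → Prop} {f : X → ℝ} {g : ℕ → X → ℝ} (hg : ∀ n, Lo F (g n))
    (h : ∀ c x, c < f x ↔ ∃ n, c < g n x) : Lo F f := by
  intro c
  have : {x | c < f x} = ⋃ n, {x | c < g n x} := by ext x; simp [h c x]
  rw [this]
  exact SigmaTwo.iUnion fun n => hg n c

lemma SigmaTwoMeasurable.lo {F : Set X → Prop} {f : X → ℝ} (hf : SigmaTwoMeasurable F f) :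
    Lo F f := fun c => hf (Set.Ioi c) isOpen_Ioi

lemma SigmaTwoMeasurable.comp_cont {F : Set X → Prop} {f : X → ℝ} (hf : SigmaTwoMeasurable F f)
    {u : ℝ → ℝ} (hu : Continuous u) : SigmaTwoMeasurable F (fun x => u (f x)) :=
  fun U hU => hf (u ⁻¹' U) (hU.preimage hu)

lemma sigmaTwoMeasurable_of_lo {f : X → ℝ} (h1 : Lo (AlgGen G) f)
    (h2 : Lo (AlgGen G) (fun x => - f x)) : SigmaTwoMeasurable (AlgGen G) f := by
  intro U hU
  have : f ⁻¹' U = ⋃ p : ℚ × ℚ, {x | x ∈ f ⁻¹' (Set.Ioo (p.1 : ℝ) p.2) ∧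
      Set.Ioo (p.1 : ℝ) p.2 ⊆ U} := by
    ext x
    simp only [Set.mem_preimage, Set.mem_iUnion, Set.mem_ofPred_eq]
    constructor
    · intro hx
      obtain ⟨v, hv, hxv, hvU⟩ := Real.isTopologicalBasis_Ioo_rat.exists_subset_of_mem_open hx hU
      simp only [Set.mem_iUnion, Set.mem_singleton_iff] at hv
      obtain ⟨a, b, hab, rfl⟩ := hv
      exact ⟨(a, b), hxv, hvU⟩
    · rintro ⟨p, hp, hU⟩
      exact hU hp
  rw [this]
  refine SigmaTwo.iUnion fun p => ?_
  by_cases hp : Set.Ioo (p.1 : ℝ) p.2 ⊆ U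
  · have : {x | x ∈ f ⁻¹' (Set.Ioo (p.1 : ℝ) p.2) ∧ Set.Ioo (p.1 : ℝ) p.2 ⊆ U} =
      {x | (p.1 : ℝ) < f x} ∩ {x | -(p.2 : ℝ) < - f x} := by
      ext x; simp [hp]
    rw [this]
    exact (h1 _).inter (h2 _)
  · simpa [hp] using SigmaTwo.of_mem (AlgGen.empty (G := G))

lemma AlgGen.preimage {Y : Type*} {G' : Set Y → Prop} (φ : X → Y)
    (h : ∀ s, G' s → G (φ ⁻¹' s)) {s : Set Y} (hs : AlgGen G' s) : AlgGen G (φ ⁻¹' s) := by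
  induction hs with
  | basic s hs => exact AlgGen.basic _ (h s hs)
  | empty => exact AlgGen.empty
  | compl s _ ih => exact AlgGen.compl _ ih
  | union s t _ _ h1 h2 => exact AlgGen.union _ _ h1 h2

lemma FunHier.comp {Y : Type*} {G' : Set Y → Prop} (φ : X → Y)
    (h : ∀ s, G' s → G (φ ⁻¹' s)) {α : Ordinal.{0}} {f : Y → ℝ}
    (hf : FunHier (SigmaTwoMeasurable (AlgGen G')) α f) :
    FunHier (SigmaTwoMeasurable (AlgGen G)) α (fun x => f (φ x)) := by
  induction hf with
  | base f hf =>
    refine FunHier.base _ fun U hU => ?_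
    obtain ⟨g, hg, hg'⟩ := hf U hU
    refine ⟨fun n => φ ⁻¹' (g n), fun n => (hg n).preimage φ h, ?_⟩
    rw [← Set.preimage_iUnion, ← hg']; rfl
  | lim α β g f h1 h2 _ h4 ih =>
    exact FunHier.lim α β (fun n x => g n (φ x)) _ h1 h2 ih fun x => h4 _

end Generic

/-! ### Resolvable sets and fragmented functions -/

section Frag

variable {X : Type*} [TopologicalSpace X]

lemma Resolvable.preimage {Y : Type*} [TopologicalSpace Y] {φ : X → Y} (hφ : Continuous φ)
    {A : Set Y} (hA : Resolvable A) : Resolvable (φ ⁻¹' A) := by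
  intro B hB
  obtain ⟨U, hU, ⟨y, ⟨x, hx, rfl⟩, hy⟩, h⟩ := hA (φ '' B) (hB.image φ)
  refine ⟨φ ⁻¹' U, hU.preimage hφ, ⟨x, hx, hy⟩, ?_⟩
  rcases h with h | h
  · left
    rintro z ⟨hz, hz'⟩
    exact h ⟨⟨z, hz, rfl⟩, hz'⟩
  · right
    ext z
    simp only [Set.mem_inter_iff, Set.mem_preimage, Set.mem_empty_iff_false, iff_false]
    rintro ⟨⟨hz, hz'⟩, hz''⟩
    exact Set.notMem_empty _ (h.le ⟨⟨⟨z, hz, rfl⟩, hz'⟩, hz''⟩)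

lemma Hs.resolvable {A : Set X} (hA : Hs X A) : Resolvable A := by
  induction hA with
  | basic s hs => exact hs
  | empty => exact fun B hB => ⟨Set.univ, isOpen_univ, by simpa using hB, by simp⟩
  | compl s _ ih =>
    intro B hB
    obtain ⟨U, hU, hne, h⟩ := ih B hB
    refine ⟨U, hU, hne, ?_⟩
    rcases h with h | h
    · right
      ext z; simp only [Set.mem_inter_iff, Set.mem_compl_iff, Set.mem_empty_iff_false, iff_false]
      rintro ⟨hz, hz'⟩; exact hz' (h hz)
    · left
      intro z hz hz'
      exact Set.notMem_empty _ (h.le ⟨hz, hz'⟩)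
  | union s t _ _ h1 h2 =>
    intro B hB
    obtain ⟨U, hU, hne, h⟩ := h1 B hB
    rcases h with h | h
    · exact ⟨U, hU, hne, Or.inl (h.trans Set.subset_union_left)⟩
    · obtain ⟨V, hV, hne', h'⟩ := h2 _ hne
      refine ⟨U ∩ V, hU.inter hV, by rwa [← Set.inter_assoc], ?_⟩
      rw [← Set.inter_assoc]
      rcases h' with h' | h'
      · exact Or.inl (h'.trans Set.subset_union_right)
      · right
        rw [Set.inter_union_distrib_left, h', Set.union_empty, ← Set.subset_empty_iff, ← h]
        exact Set.inter_subset_inter_left _ Set.inter_subset_left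

/-- Fragmented real functions. -/
def Frag (f : X → ℝ) : Prop :=
  ∀ ε > 0, ∀ B : Set X, B.Nonempty →
    ∃ U : Set X, IsOpen U ∧ (B ∩ U).Nonempty ∧ ∀ x ∈ B ∩ U, ∀ y ∈ B ∩ U, f x - f y < ε

lemma Frag.add {f g : X → ℝ} (hf : Frag f) (hg : Frag g) : Frag (fun x => f x + g x) := by
  intro ε hε B hB
  obtain ⟨U, hU, hne, h⟩ := hf (ε / 2) (by positivity) B hB
  obtain ⟨V, hV, hne', h'⟩ := hg (ε / 2) (by positivity) _ hne
  refine ⟨U ∩ V, hU.inter hV, by rwa [← Set.inter_assoc], ?_⟩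
  rw [← Set.inter_assoc]
  intro x hx y hy
  have := h x hx.1 y hy.1
  have := h' x hx y hy
  linarith

lemma Frag.neg {f : X → ℝ} (hf : Frag f) : Frag (fun x => - f x) := by
  intro ε hε B hB
  obtain ⟨U, hU, hne, h⟩ := hf ε hε B hB
  exact ⟨U, hU, hne, fun x hx y hy => by have := h y hy x hx; linarith⟩

/-- Bounded lower semicontinuous functions are fragmented. -/
lemma Frag.of_lsc {f : X → ℝ} (hf : ∀ c, IsOpen {x | c < f x}) (C : ℝ) (hC : ∀ x, f x ≤ C) :
    Frag f := by
  intro ε hε B hB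
  have hbdd : BddAbove (f '' B) := ⟨C, by rintro _ ⟨x, _, rfl⟩; exact hC x⟩
  obtain ⟨_, ⟨x, hx, rfl⟩, h⟩ := exists_lt_of_lt_csSup (hB.image f)
    (show sSup (f '' B) - ε < sSup (f '' B) by linarith)
  refine ⟨_, hf (sSup (f '' B) - ε), ⟨x, hx, h⟩, fun y hy z hz => ?_⟩
  have := le_csSup hbdd (Set.mem_image_of_mem f hy.1)
  have h2 : sSup (f '' B) - ε < f z := hz.2
  linarith

lemma Frag.separate {f : X → ℝ} (hf : Frag f) {a b : ℝ} (hab : a < b) :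
    ∃ A : Set X, Resolvable A ∧ {x | b ≤ f x} ⊆ A ∧ A ⊆ {x | a < f x} := by
  let T := {p : Set X × Set X // IsOpen p.1 ∧ p.2 ⊆ p.1 ∧ Resolvable p.2 ∧
    p.1 ∩ {x | b ≤ f x} ⊆ p.2 ∧ p.2 ⊆ {x | a < f x}}
  let r : T → T → Prop := fun p q => p.1.1 ⊆ q.1.1 ∧ q.1.2 ∩ p.1.1 = p.1.2
  obtain ⟨⟨⟨U, A⟩, hU, hAU, hA, h1, h2⟩, hm⟩ : ∃ m : T, ∀ p, r m p → r p m := by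
    refine exists_maximal_of_chains_bounded ?_ ?_
    · intro c hc
      have key : ∀ p ∈ c, ∀ q ∈ c, q.1.2 ∩ p.1.1 ⊆ p.1.2 := by
        intro p hp q hq
        by_cases hpq : p = q
        · subst hpq; exact Set.inter_subset_left
        rcases hc hp hq hpq with h | h
        · exact h.2.le
        · intro x hx
          have : x ∈ p.1.2 ∩ q.1.1 := h.2 ▸ hx.1
          exact this.1
      have key2 : ∀ p ∈ c, (⋃ q ∈ c, q.1.2) ∩ p.1.1 = p.1.2 := by
        intro p hp
        apply Set.Subset.antisymm
        · rintro x ⟨hx, hxp⟩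
          simp only [Set.mem_iUnion] at hx
          obtain ⟨q, hq, hx⟩ := hx
          exact key p hp q hq ⟨hx, hxp⟩
        · intro x hx
          exact ⟨Set.mem_biUnion hp hx, p.2.2.1 hx⟩
      refine ⟨⟨(⋃ p ∈ c, p.1.1, ⋃ p ∈ c, p.1.2), isOpen_biUnion fun p _ => p.2.1,
        Set.iUnion₂_mono fun p _ => p.2.2.1, ?_, ?_, ?_⟩, fun p hp =>
        ⟨Set.subset_biUnion_of_mem (u := fun q : T => q.1.1) hp, key2 p hp⟩⟩
      · intro B hB
        by_cases hBU : ∃ p ∈ c, (B ∩ p.1.1).Nonempty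
        · obtain ⟨p, hp, hne⟩ := hBU
          obtain ⟨W, hW, hne', h⟩ := p.2.2.2.1 _ hne
          refine ⟨p.1.1 ∩ W, p.2.1.inter hW, by rwa [← Set.inter_assoc], ?_⟩
          rw [← Set.inter_assoc]
          rcases h with h | h
          · left
            intro x hx
            exact Set.mem_biUnion hp (h hx)
          · right
            rw [← Set.subset_empty_iff, ← h]
            rintro x ⟨hx, hx'⟩
            refine ⟨hx, ?_⟩
            rw [← key2 p hp]
            exact ⟨hx', hx.1.2⟩
        · refine ⟨Set.univ, isOpen_univ, by simpa using hB, Or.inr ?_⟩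
          rw [← Set.subset_empty_iff]
          rintro x ⟨⟨hx, -⟩, hx'⟩
          simp only [Set.mem_iUnion] at hx'
          obtain ⟨p, hp, hx'⟩ := hx'
          exact hBU ⟨p, hp, x, hx, p.2.2.1 hx'⟩
      · rintro x ⟨hx, hx'⟩
        simp only [Set.mem_iUnion] at hx
        obtain ⟨p, hp, hx⟩ := hx
        exact Set.mem_biUnion hp (p.2.2.2.2.1 ⟨hx, hx'⟩)
      · exact Set.iUnion₂_subset fun p _ => p.2.2.2.2.2
    · rintro p q s ⟨h1, h2⟩ ⟨h3, h4⟩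
      refine ⟨h1.trans h3, ?_⟩
      rw [← h2, ← h4, Set.inter_assoc, Set.inter_eq_right.2 h1]
  by_cases hne : (Uᶜ).Nonempty
  swap
  · have : U = Set.univ := by
      rw [Set.not_nonempty_iff_eq_empty, Set.compl_empty_iff] at hne
      exact hne
    subst this
    exact ⟨A, hA, by simpa using h1, h2⟩
  exfalso
  obtain ⟨W, hW, hne', hosc⟩ := hf (b - a) (by linarith) _ hne
  -- any set `D` that is `∅` or `Uᶜ ∩ W` gives a resolvable extension
  have res : ∀ D : Set X, (D = ∅ ∨ D = Uᶜ ∩ W) → Resolvable (A ∪ D) := by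
    intro D hD B hB
    have hDU : D ⊆ Uᶜ ∩ W := by rcases hD with rfl | rfl <;> simp
    by_cases hBU : (B ∩ U).Nonempty
    · obtain ⟨V, hV, hne, h⟩ := hA _ hBU
      refine ⟨U ∩ V, hU.inter hV, by rwa [← Set.inter_assoc], ?_⟩
      rw [← Set.inter_assoc]
      rcases h with h | h
      · exact Or.inl (h.trans Set.subset_union_left)
      · right
        rw [← Set.subset_empty_iff, ← h]
        rintro x ⟨hx, hx' | hx'⟩
        · exact ⟨hx, hx'⟩
        · exact absurd hx.1.2 (hDU hx').1
    · have hBU' : ∀ x ∈ B, x ∉ U := fun x hx hxU => hBU ⟨x, hx, hxU⟩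
      by_cases hBW : (B ∩ W).Nonempty
      · refine ⟨W, hW, hBW, ?_⟩
        rcases hD with rfl | rfl
        · right
          rw [← Set.subset_empty_iff]
          rintro x ⟨hx, hx' | hx'⟩
          · exact hBU' x hx.1 (hAU hx')
          · exact hx'
        · left
          intro x hx
          exact Or.inr ⟨hBU' x hx.1, hx.2⟩
      · refine ⟨Set.univ, isOpen_univ, by simpa using hB, Or.inr ?_⟩
        rw [← Set.subset_empty_iff]
        rintro x ⟨⟨hx, -⟩, hx' | hx'⟩
        · exact hBU' x hx (hAU hx')
        · exact hBW ⟨x, hx, (hDU hx').2⟩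
  have main : ∀ D : Set X, (D = ∅ ∨ D = Uᶜ ∩ W) → (Uᶜ ∩ W) ∩ {x | b ≤ f x} ⊆ D →
      D ⊆ {x | a < f x} → False := by
    intro D hD hD1 hD2
    have hDU : D ⊆ Uᶜ ∩ W := by rcases hD with rfl | rfl <;> simp
    have := hm ⟨(U ∪ W, A ∪ D), hU.union hW, Set.union_subset_union hAU
      (hDU.trans Set.inter_subset_right), res D hD, ?_, Set.union_subset h2 hD2⟩
      ⟨Set.subset_union_left, ?_⟩
    · obtain ⟨x, hx, hx'⟩ := hne'
      exact hx (this.1 (Or.inr hx'))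
    · rintro x ⟨hx, hx'⟩
      by_cases hxU : x ∈ U
      · exact Or.inl (h1 ⟨hxU, hx'⟩)
      · exact Or.inr (hD1 ⟨⟨hxU, hx.resolve_left hxU⟩, hx'⟩)
    · apply Set.Subset.antisymm
      · rintro x ⟨hx | hx, hx'⟩
        · exact hx
        · exact absurd hx' (hDU hx).1
      · exact fun x hx => ⟨Or.inl hx, hAU hx⟩
  by_cases hD : Uᶜ ∩ W ⊆ {x | a < f x}
  · exact main _ (Or.inr rfl) Set.inter_subset_left hD
  · rw [Set.not_subset] at hD
    obtain ⟨y, hy, hy'⟩ := hD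
    refine main ∅ (Or.inl rfl) ?_ (by simp)
    rintro x ⟨hx, hx'⟩
    have h3 := hosc x hx y hy
    simp only [Set.mem_ofPred_eq] at hx' hy'
    linarith

lemma Frag.lo {f : X → ℝ} (hf : Frag f) : Lo (Hs X) f := by
  intro c
  have h : ∀ n : ℕ, c < c + 1 / ((n : ℝ) + 1) := fun n => by
    have : 0 < 1 / ((n : ℝ) + 1) := by positivity
    linarith
  choose A hA h1 h2 using fun n : ℕ => hf.separate (h n)
  refine ⟨A, fun n => AlgGen.basic _ (hA n), ?_⟩
  apply Set.Subset.antisymm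
  · intro x hx
    obtain ⟨n, hn⟩ := exists_nat_one_div_lt (show 0 < f x - c by simpa using hx)
    exact Set.mem_iUnion.2 ⟨n, h1 n (by simp only [Set.mem_ofPred_eq]; linarith)⟩
  · exact Set.iUnion_subset h2

end Frag

/-! ### The space of Radon probability measures -/

section Radon

variable {K : Type*} [TopologicalSpace K] [CompactSpace K] [T2Space K]
    [MeasurableSpace K] [BorelSpace K]

instance (μ : RadonProb K) : IsProbabilityMeasure μ.measure :=
  inferInstanceAs (IsProbabilityMeasure (μ.1.toMeasure))

instance (μ : RadonProb K) : μ.measure.InnerRegular := μ.2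

lemma continuous_tilde {g : K → ℝ} (hg : Continuous g) :
    Continuous (fun μ : RadonProb K => ∫ x, g x ∂μ.measure) :=
  (ProbabilityMeasure.continuous_integral_continuousMap (⟨g, hg⟩ : C(K, ℝ))).comp
    continuous_subtype_val

lemma exists_compact_real (μ : RadonProb K) {A : Set K} (hA : MeasurableSet A) {ε : ℝ}
    (hε : 0 < ε) : ∃ C ⊆ A, IsCompact C ∧ μ.measure.real A < μ.measure.real C + ε := by
  obtain ⟨C, hCA, hC, h⟩ := hA.exists_isCompact_lt_add (measure_ne_top μ.measure A)
    (ε := ENNReal.ofReal ε) (by simpa using hε)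
  refine ⟨C, hCA, hC, ?_⟩
  have := (ENNReal.toReal_lt_toReal (measure_ne_top _ _) (by simp)).2 h
  rwa [ENNReal.toReal_add (by simp) (by simp), ENNReal.toReal_ofReal hε.le] at this

lemma isOpen_lt_measure {U : Set K} (hU : IsOpen U) (c : ℝ) :
    IsOpen {μ : RadonProb K | c < μ.measure.real U} := by
  rw [isOpen_iff_mem_nhds]
  intro μ hμ
  have hμ' : c < μ.measure.real U := hμ
  obtain ⟨C, hCU, hC, h⟩ := exists_compact_real μ hU.measurableSet (sub_pos.2 hμ')
  obtain ⟨g, hg0, hg1, hg⟩ := exists_continuous_zero_one_of_isClosed hU.isClosed_compl hC.isClosed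
    (Set.disjoint_left.2 fun x hx hx' => hx (hCU hx'))
  have hint : ∀ ν : RadonProb K, Integrable (fun x => g x) ν.measure := fun ν =>
    Integrable.of_bound g.continuous.aestronglyMeasurable 1
      (Filter.Eventually.of_forall fun x => by
        rw [Real.norm_eq_abs, abs_le]; constructor <;> linarith [(hg x).1, (hg x).2])
  have ho := (continuous_tilde g.continuous).isOpen_preimage (Set.Ioi c) isOpen_Ioi
  refine Filter.mem_of_superset (ho.mem_nhds ?_) ?_
  · change c < ∫ x, g x ∂μ.measure
    calc c < μ.measure.real C := by linarith
      _ = ∫ x, C.indicator (fun _ => (1 : ℝ)) x ∂μ.measure := by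
        rw [integral_indicator_const _ hC.measurableSet]; simp
      _ ≤ ∫ x, g x ∂μ.measure := by
        refine integral_mono ((integrable_const _).indicator hC.measurableSet) (hint μ) fun x => ?_
        by_cases hx : x ∈ C
        · simp [hx, hg1 hx]
        · simpa [hx] using (hg x).1
  · intro ν hν
    have hν' : c < ∫ x, g x ∂ν.measure := hν
    change c < ν.measure.real U
    calc c < ∫ x, g x ∂ν.measure := hν'
      _ ≤ ∫ x, U.indicator (fun _ => (1 : ℝ)) x ∂ν.measure := by
        refine integral_mono (hint ν) ((integrable_const _).indicator hU.measurableSet) fun x => ?_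
        by_cases hx : x ∈ U
        · simpa [hx] using (hg x).2
        · simpa [hx] using (hg0 hx).le
      _ = ν.measure.real U := by
        rw [integral_indicator_const _ hU.measurableSet]; simp

lemma frag_open {U : Set K} (hU : IsOpen U) :
    Frag (fun μ : RadonProb K => μ.measure.real U) :=
  Frag.of_lsc (isOpen_lt_measure hU) 1 fun _ => measureReal_le_one

lemma tau_additive {c : Set (Set K)} (hc : IsChain (· ⊆ ·) c) (hne : c.Nonempty)
    (ho : ∀ U ∈ c, IsOpen U) (μ : RadonProb K) {ε : ℝ} (hε : 0 < ε) :
    ∃ U ∈ c, μ.measure.real (⋃₀ c) < μ.measure.real U + ε := by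
  obtain ⟨C, hCU, hC, h⟩ := exists_compact_real μ (isOpen_sUnion ho).measurableSet hε
  have : Nonempty c := hne.to_subtype
  obtain ⟨U, hU⟩ := hC.elim_directed_cover (fun U : c => (U : Set K)) (fun U => ho _ U.2)
    (by rwa [Set.sUnion_eq_iUnion] at hCU) hc.directedOn.directed_val
  refine ⟨U, U.2, h.trans_le ?_⟩
  gcongr
  exact measure_ne_top _ _

lemma Resolvable.core {H : Set K} (hH : Resolvable H) :
    (∀ μ : RadonProb K, NullMeasurableSet H μ.measure) ∧
      Frag (fun μ : RadonProb K => μ.measure.real H) := by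
  let S : Set (Set K) := {U | IsOpen U ∧ (∀ μ : RadonProb K, NullMeasurableSet (H ∩ U) μ.measure) ∧
      Frag (fun μ : RadonProb K => μ.measure.real (H ∩ U))}
  have h0 : (∅ : Set K) ∈ S := by
    refine ⟨isOpen_empty, by simp, ?_⟩
    simpa using frag_open (K := K) isOpen_empty
  obtain ⟨U, -, ⟨hU, hUm, hUf⟩, hmax⟩ := zorn_subset_nonempty S (fun c hcS hc hne => by
    have ho : ∀ U ∈ c, IsOpen U := fun U hU => (hcS hU).1
    refine ⟨⋃₀ c, ⟨isOpen_sUnion ho, fun μ => ?_, ?_⟩, fun s hs => Set.subset_sUnion_of_mem hs⟩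
    · choose V hV hV' using fun n : ℕ => tau_additive hc hne ho μ
        (show 0 < 1 / ((n : ℝ) + 1) by positivity)
      have hnull : μ.measure (⋃₀ c \ ⋃ n, V n) = 0 := by
        have hle : μ.measure.real (⋃₀ c \ ⋃ n, V n) ≤ 0 := by
          refine le_of_forall_pos_lt_add fun ε hε => ?_
          obtain ⟨n, hn⟩ := exists_nat_one_div_lt hε
          calc μ.measure.real (⋃₀ c \ ⋃ n, V n) ≤ μ.measure.real (⋃₀ c \ V n) :=
                measureReal_mono (Set.sdiff_subset_sdiff_right (Set.subset_iUnion V n))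
            _ = μ.measure.real (⋃₀ c) - μ.measure.real (V n) :=
                measureReal_sdiff (Set.subset_sUnion_of_mem (hV n)) (ho _ (hV n)).measurableSet
            _ < 0 + ε := by have := hV' n; linarith
        have : μ.measure.real (⋃₀ c \ ⋃ n, V n) = 0 := le_antisymm hle measureReal_nonneg
        simpa [measureReal_eq_zero_iff] using this
      have : H ∩ ⋃₀ c = (⋃ n, H ∩ V n) ∪ (H ∩ (⋃₀ c \ ⋃ n, V n)) := by
        rw [← Set.inter_iUnion, ← Set.inter_union_distrib_left, Set.union_sdiff_cancel]
        exact Set.iUnion_subset fun n => Set.subset_sUnion_of_mem (hV n)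
      rw [this]
      exact (NullMeasurableSet.iUnion fun n => (hcS (hV n)).2.1 μ).union
        (NullMeasurableSet.of_null (measure_mono_null Set.inter_subset_right hnull))
    · intro ε hε B hB
      have hVo := isOpen_sUnion ho
      set V := ⋃₀ c with hVdef
      let φ : RadonProb K → ℝ := fun μ => μ.measure.real V
      have hbdd : BddAbove (φ '' B) := ⟨1, by rintro _ ⟨x, _, rfl⟩; exact measureReal_le_one⟩
      obtain ⟨_, ⟨μ, hμ, rfl⟩, hlt⟩ := exists_lt_of_lt_csSup (hB.image φ)
        (show sSup (φ '' B) - ε / 4 < sSup (φ '' B) by linarith)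
      obtain ⟨U, hU, hUV⟩ := tau_additive hc hne ho μ (sub_pos.2 hlt)
      have hltU : sSup (φ '' B) - ε / 4 < μ.measure.real U := by
        change φ μ < _ at hUV
        linarith
      have hW := isOpen_lt_measure (ho U hU) (sSup (φ '' B) - ε / 4)
      obtain ⟨W, hWo, hWne, hosc⟩ := (hcS hU).2.2 (ε / 2) (by positivity) (B ∩ {μ : RadonProb K | sSup (φ '' B) - ε / 4 < μ.measure.real U})
        ⟨μ, hμ, hltU⟩
      refine ⟨_ ∩ W, hW.inter hWo, by rwa [← Set.inter_assoc], ?_⟩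
      rw [← Set.inter_assoc]
      intro x hx y hy
      have e1 := hosc x hx y hy
      have hsub : U ⊆ V := Set.subset_sUnion_of_mem hU
      have e2 : y.measure.real (H ∩ U) ≤ y.measure.real (H ∩ V) :=
        measureReal_mono (Set.inter_subset_inter_right _ hsub)
      have e3 : x.measure.real (H ∩ V) ≤ x.measure.real (H ∩ U) + x.measure.real (V \ U) := by
        refine (measureReal_mono ?_).trans (measureReal_union_le _ _)
        rintro z ⟨hz, hz'⟩
        by_cases hzU : z ∈ U
        · exact Or.inl ⟨hz, hzU⟩
        · exact Or.inr ⟨hz', hzU⟩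
      have e4 : x.measure.real (V \ U) = x.measure.real V - x.measure.real U :=
        measureReal_sdiff hsub (ho U hU).measurableSet
      have e5 : x.measure.real V ≤ sSup (φ '' B) := le_csSup hbdd (Set.mem_image_of_mem φ hx.1.1)
      have e6 : sSup (φ '' B) - ε / 4 < x.measure.real U := hx.1.2
      linarith) ∅ h0
  by_cases hne : (Uᶜ).Nonempty
  swap
  · have : U = Set.univ := by
      rw [Set.not_nonempty_iff_eq_empty, Set.compl_empty_iff] at hne
      exact hne
    subst this
    simp only [Set.inter_univ] at hUm hUf
    exact ⟨hUm, hUf⟩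
  exfalso
  obtain ⟨W, hW, hne', h⟩ := hH _ hne
  have hmem : U ∪ W ∈ S := by
    rcases h with h | h
    · have e : H ∩ (U ∪ W) = (H ∩ U) ∪ (Uᶜ ∩ W) := by
        ext x
        have := @h x
        simp only [Set.mem_inter_iff, Set.mem_union, Set.mem_compl_iff] at this ⊢
        tauto
      have hm : MeasurableSet (Uᶜ ∩ W) := hU.measurableSet.compl.inter hW.measurableSet
      refine ⟨hU.union hW, fun μ => ?_, ?_⟩
      · rw [e]; exact (hUm μ).union hm.nullMeasurableSet
      · have e2 : (fun μ : RadonProb K => μ.measure.real (H ∩ (U ∪ W))) = fun μ =>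
            (μ.measure.real (H ∩ U)) + (μ.measure.real (U ∪ W) + - μ.measure.real U) := by
          funext μ
          have e3 : Uᶜ ∩ W = (U ∪ W) \ U := by ext x; simp; tauto
          rw [e, measureReal_union (Set.disjoint_left.2 fun x hx hx' => hx'.1 hx.2) hm, e3,
            measureReal_sdiff Set.subset_union_left hU.measurableSet]
          ring
        rw [e2]
        exact hUf.add ((frag_open (hU.union hW)).add (frag_open hU).neg)
    · have e : H ∩ (U ∪ W) = H ∩ U := by
        ext x
        have : x ∉ Uᶜ ∩ W ∩ H := by rw [h]; simp
        simp only [Set.mem_inter_iff, Set.mem_union, Set.mem_compl_iff] at this ⊢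
        tauto
      refine ⟨hU.union hW, ?_, ?_⟩
      · rw [e]; exact hUm
      · rw [e]; exact hUf
  obtain ⟨x, hx, hx'⟩ := hne'
  exact hx (hmax hmem Set.subset_union_left (Or.inr hx'))

/-- The core property connecting an algebra on `K` and an algebra on `M¹(K)`. -/
def CoreHyp (G : Set K → Prop) (G' : Set (RadonProb K) → Prop) : Prop :=
  ∀ H, AlgGen G H → (∀ μ : RadonProb K, NullMeasurableSet H μ.measure) ∧
    Lo (AlgGen G') (fun μ : RadonProb K => μ.measure.real H)

lemma coreHyp_res : CoreHyp (K := K) (fun s => Resolvable s) (fun s => Resolvable s) := by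
  intro H hH
  have := (Hs.resolvable hH).core
  exact ⟨this.1, this.2.lo⟩

lemma bos_measurable {H : Set K} (hH : Bos K H) : MeasurableSet H := by
  induction hH with
  | basic s hs => exact IsOpen.measurableSet hs
  | empty => exact MeasurableSet.empty
  | compl s _ ih => exact ih.compl
  | union s t _ _ h1 h2 => exact h1.union h2

lemma bos_adjoin {H : Set K} (hH : Bos K H) : H.indicator (1 : K → ℝ) ∈
    Algebra.adjoin ℝ {g : K → ℝ | ∃ U, IsOpen U ∧ g = U.indicator 1} := by
  induction hH with
  | basic s hs => exact Algebra.subset_adjoin ⟨s, hs, rfl⟩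
  | empty => rw [Set.indicator_empty']; exact zero_mem _
  | compl s _ ih =>
    rw [Set.indicator_compl]
    exact sub_mem (one_mem _) ih
  | union s t _ _ h1 h2 =>
    have : (s ∪ t).indicator (1 : K → ℝ) =
        s.indicator 1 + t.indicator 1 - s.indicator 1 * t.indicator 1 := by
      ext x
      by_cases hs : x ∈ s <;> by_cases ht : x ∈ t <;> simp [hs, ht]
    rw [this]
    exact sub_mem (add_mem h1 h2) (mul_mem h1 h2)

lemma coreHyp_bos : CoreHyp (K := K) (fun s => IsOpen s) (fun s => IsOpen s) := by
  intro H hH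
  have hm := bos_measurable hH
  refine ⟨fun μ => hm.nullMeasurableSet, ?_⟩
  have h1 := bos_adjoin hH
  rw [← Subalgebra.mem_toSubmodule, Algebra.adjoin_eq_span] at h1
  have h2 : ∀ g ∈ Submonoid.closure {g : K → ℝ | ∃ U, IsOpen U ∧ g = U.indicator 1},
      ∃ U : Set K, IsOpen U ∧ g = U.indicator 1 := by
    intro g hg
    induction hg using Submonoid.closure_induction with
    | mem g hg => exact hg
    | one => exact ⟨Set.univ, isOpen_univ, by simp⟩
    | mul x y _ _ hx hy =>
      obtain ⟨U, hU, rfl⟩ := hx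
      obtain ⟨V, hV, rfl⟩ := hy
      exact ⟨U ∩ V, hU.inter hV, by rw [Set.inter_indicator_one]⟩
  have h3 : ∀ g ∈ Submodule.span ℝ
      (Submonoid.closure {g : K → ℝ | ∃ U, IsOpen U ∧ g = U.indicator 1} : Set (K → ℝ)),
      (∀ μ : RadonProb K, Integrable g μ.measure) ∧
      Lo (AlgGen fun s => IsOpen s) (fun μ : RadonProb K => ∫ x, g x ∂μ.measure) ∧
      Lo (AlgGen fun s => IsOpen s) (fun μ : RadonProb K => -∫ x, g x ∂μ.measure) := by
    intro g hg
    induction hg using Submodule.span_induction with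
    | mem g hg =>
      obtain ⟨U, hU, rfl⟩ := h2 g hg
      refine ⟨fun μ => (integrable_const (1 : ℝ)).indicator hU.measurableSet, ?_, ?_⟩
      · intro c
        refine SigmaTwo.of_mem (AlgGen.basic _ ?_)
        simp only [integral_indicator_one hU.measurableSet]
        exact isOpen_lt_measure hU c
      · simp only [integral_indicator_one hU.measurableSet]
        intro c
        refine ⟨fun n => {μ : RadonProb K | - c - 1 / ((n : ℝ) + 1) < μ.measure.real U}ᶜ,
          fun n => AlgGen.compl _ (AlgGen.basic _ (isOpen_lt_measure hU _)), ?_⟩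
        ext μ
        simp only [Set.mem_ofPred_eq, Set.mem_compl_iff, not_lt, Set.mem_iUnion]
        constructor
        · intro h
          obtain ⟨n, hn⟩ := exists_nat_one_div_lt (show 0 < - c - μ.measure.real U by linarith)
          exact ⟨n, by linarith⟩
        · rintro ⟨n, hn⟩
          have : 0 < 1 / ((n : ℝ) + 1) := by positivity
          linarith
    | zero =>
      refine ⟨fun μ => integrable_zero _ _ _, ?_, ?_⟩
      · simpa using Lo.const (X := RadonProb K) (G := fun s => IsOpen s) 0
      · simpa using Lo.const (X := RadonProb K) (G := fun s => IsOpen s) 0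
    | add x y _ _ hx hy =>
      refine ⟨fun μ => (hx.1 μ).add (hy.1 μ), ?_, ?_⟩
      · simp only [Pi.add_apply, integral_add (hx.1 _) (hy.1 _)]
        exact hx.2.1.add hy.2.1
      · simp only [Pi.add_apply, integral_add (hx.1 _) (hy.1 _), neg_add]
        exact hx.2.2.add hy.2.2
    | smul a x _ hx =>
      refine ⟨fun μ => (hx.1 μ).smul a, ?_⟩
      simp only [Pi.smul_apply, smul_eq_mul, integral_const_mul]
      rcases le_total 0 a with ha | ha
      · refine ⟨hx.2.1.const_mul ha, ?_⟩
        simp only [← mul_neg]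
        exact hx.2.2.const_mul ha
      · have ha' : 0 ≤ -a := by linarith
        constructor
        · simpa only [neg_mul_neg] using hx.2.2.const_mul ha'
        · simpa only [neg_mul] using hx.2.1.const_mul ha'
  simpa only [integral_indicator_one hm] using (h3 _ h1).2.1

end Radon

section Hier

variable {K : Type*} [TopologicalSpace K] [CompactSpace K] [T2Space K]
    [MeasurableSpace K] [BorelSpace K] {G : Set K → Prop} {G' : Set (RadonProb K) → Prop}

lemma CoreHyp.nullMeas (h : CoreHyp G G') {s : Set K} (hs : SigmaTwo (AlgGen G) s)
    (μ : RadonProb K) : NullMeasurableSet s μ.measure := by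
  obtain ⟨g, hg, rfl⟩ := hs
  exact NullMeasurableSet.iUnion fun n => (h _ (hg n)).1 μ

lemma CoreHyp.aemeas (h : CoreHyp G G') {f : K → ℝ} (hf : Lo (AlgGen G) f)
    (μ : RadonProb K) : AEMeasurable f μ.measure := by
  have : NullMeasurable f μ.measure :=
    @measurable_of_Ioi ℝ (NullMeasurableSpace K μ.measure) _ _ _ _ _ _ _ f
      fun c => h.nullMeas (hf c) μ
  exact this.aemeasurable

lemma CoreHyp.lo_set (h : CoreHyp G G') {s : Set K} (hs : SigmaTwo (AlgGen G) s) :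
    Lo (AlgGen G') (fun μ : RadonProb K => μ.measure.real s) := by
  obtain ⟨g, hg, rfl⟩ := hs
  have hacc : ∀ n, AlgGen G (Set.accumulate g n) := by
    intro n
    induction n with
    | zero => simpa using hg 0
    | succ n ih => rw [Set.accumulate_succ]; exact AlgGen.union _ _ ih (hg _)
  refine Lo.of_sup (fun n => (h _ (hacc n)).2) fun c μ => ?_
  have ht : Tendsto (fun n => μ.measure.real (Set.accumulate g n)) atTop
      (𝓝 (μ.measure.real (⋃ n, g n))) :=
    (ENNReal.tendsto_toReal (measure_ne_top _ _)).comp tendsto_measure_iUnion_accumulate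
  constructor
  · intro hc
    exact (ht.eventually (lt_mem_nhds hc)).exists
  · rintro ⟨n, hn⟩
    exact hn.trans_le (measureReal_mono (Set.accumulate_subset_iUnion n))

lemma count_bounds (z : ℝ) (hz : 0 ≤ z) (M : ℕ) :
    (∑ i ∈ Finset.range M, (if ((i : ℝ) + 1) < z then (1 : ℝ) else 0)) ≤ z ∧
    (∑ i ∈ Finset.range M, (if ((i : ℝ) + 1) < z then (1 : ℝ) else 0)) ≤ M ∧
    min (z - 1) M ≤ (∑ i ∈ Finset.range M, (if ((i : ℝ) + 1) < z then (1 : ℝ) else 0)) := by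
  induction M with
  | zero => simp [hz]
  | succ M ih =>
    obtain ⟨h1, h2, h3⟩ := ih
    rw [Finset.sum_range_succ]
    push_cast
    by_cases hM : (M : ℝ) + 1 < z
    · rw [if_pos hM]
      rw [min_eq_right (by linarith)] at h3
      refine ⟨by linarith, by linarith, (min_le_right _ _).trans (by linarith)⟩
    · rw [if_neg hM]
      rw [min_eq_left (by linarith)] at h3
      refine ⟨by linarith, by linarith, (min_le_left _ _).trans (by linarith)⟩

lemma CoreHyp.lo_nonneg (h : CoreHyp G G') {f : K → ℝ} (hf : Lo (AlgGen G) f)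
    (h0 : ∀ x, 0 ≤ f x) (N : ℕ) (hN : ∀ x, f x ≤ N) :
    Lo (AlgGen G') (fun μ : RadonProb K => ∫ x, f x ∂μ.measure) := by
  let A : ℕ → ℕ → Set K := fun n i => {x | ((i : ℝ) + 1) / ((n : ℝ) + 1) < f x}
  let g : ℕ → K → ℝ := fun n x => (1 / ((n : ℝ) + 1)) *
    ∑ i ∈ Finset.range ((n + 1) * N), (A n i).indicator (fun _ => (1 : ℝ)) x
  have hA : ∀ n i μ, NullMeasurableSet (A n i) (RadonProb.measure μ) := fun n i μ =>
    h.nullMeas (hf _) μ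
  have hAi : ∀ n i (μ : RadonProb K),
      Integrable ((A n i).indicator (fun _ => (1 : ℝ))) μ.measure := fun n i μ =>
    (integrable_const (1 : ℝ)).indicator₀ (hA n i μ)
  have hgi : ∀ n (μ : RadonProb K), Integrable (g n) μ.measure := fun n μ =>
    (integrable_finset_sum _ fun i _ => hAi n i μ).const_mul _
  have hgint : ∀ n (μ : RadonProb K), ∫ x, g n x ∂μ.measure = (1 / ((n : ℝ) + 1)) *
      ∑ i ∈ Finset.range ((n + 1) * N), μ.measure.real (A n i) := by
    intro n μ
    simp only [g]
    rw [integral_const_mul, integral_finset_sum _ fun i _ => hAi n i μ]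
    congr 1
    refine Finset.sum_congr rfl fun i _ => ?_
    rw [integral_indicator₀ (hA n i μ)]
    simp
  have hfi : ∀ μ : RadonProb K, Integrable f μ.measure := fun μ =>
    Integrable.of_bound (h.aemeas hf μ).aestronglyMeasurable N
      (Filter.Eventually.of_forall fun x => by
        rw [Real.norm_eq_abs, abs_of_nonneg (h0 x)]; exact hN x)
  have hg : ∀ n x, g n x ≤ f x ∧ f x - 1 / ((n : ℝ) + 1) ≤ g n x := by
    intro n x
    have hn : (0 : ℝ) < (n : ℝ) + 1 := by positivity
    have hx : ((n : ℝ) + 1) * f x ≤ (((n + 1) * N : ℕ) : ℝ) := by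
      push_cast
      exact mul_le_mul_of_nonneg_left (hN x) hn.le
    obtain ⟨h1, -, h3⟩ := count_bounds (((n : ℝ) + 1) * f x) (mul_nonneg hn.le (h0 x))
      ((n + 1) * N)
    rw [min_eq_left (by linarith)] at h3
    have he : g n x = (1 / ((n : ℝ) + 1)) * ∑ i ∈ Finset.range ((n + 1) * N),
        (if ((i : ℝ) + 1) < ((n : ℝ) + 1) * f x then (1 : ℝ) else 0) := by
      simp only [g]
      congr 1
      refine Finset.sum_congr rfl fun i _ => ?_
      simp only [Set.indicator_apply, A, Set.mem_ofPred_eq, div_lt_iff₀ hn, mul_comm]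
    rw [he, one_div, inv_mul_eq_div]
    constructor
    · rw [div_le_iff₀ hn]; linarith
    · rw [le_div_iff₀ hn, sub_mul, inv_mul_cancel₀ hn.ne']; linarith
  refine Lo.of_sup (g := fun n μ => ∫ x, g n x ∂μ.measure) ?_ ?_
  · intro n
    simp only [hgint]
    exact (Lo.sum _ fun i _ => h.lo_set (hf _)).const_mul (by positivity)
  · intro c μ
    constructor
    · intro hc
      obtain ⟨n, hn⟩ := exists_nat_one_div_lt (sub_pos.2 hc)
      refine ⟨n, ?_⟩
      have : ∫ x, (f x - 1 / ((n : ℝ) + 1)) ∂μ.measure ≤ ∫ x, g n x ∂μ.measure :=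
        integral_mono ((hfi μ).sub (integrable_const _)) (hgi n μ) fun x => (hg n x).2
      rw [integral_sub (hfi μ) (integrable_const _)] at this
      simp only [integral_const, probReal_univ, smul_eq_mul, one_mul] at this
      linarith
    · rintro ⟨n, hn⟩
      exact hn.trans_le (integral_mono (hgi n μ) (hfi μ) fun x => (hg n x).1)

lemma CoreHyp.lo_tilde (h : CoreHyp G G') {f : K → ℝ} (hf : Lo (AlgGen G) f)
    (C : ℝ) (hC : ∀ x, |f x| ≤ C) :
    Lo (AlgGen G') (fun μ : RadonProb K => ∫ x, f x ∂μ.measure) := by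
  obtain ⟨N, hN⟩ := exists_nat_ge (2 * C)
  have h1 := h.lo_nonneg (hf.add (Lo.const C)) (fun x => by have := abs_le.1 (hC x); linarith) N
    (fun x => by have := abs_le.1 (hC x); linarith)
  have h2 := h1.add (Lo.const (-C))
  have : ∀ μ : RadonProb K, ∫ x, (f x + C) ∂μ.measure + -C = ∫ x, f x ∂μ.measure := by
    intro μ
    rw [integral_add (Integrable.of_bound (h.aemeas hf μ).aestronglyMeasurable C
      (Filter.Eventually.of_forall hC)) (integrable_const _)]
    simp
  simpa only [this] using h2

lemma CoreHyp.measurable_tilde (h : CoreHyp G G') {f : K → ℝ}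
    (hf : SigmaTwoMeasurable (AlgGen G) f) (C : ℝ) (hC : ∀ x, |f x| ≤ C) :
    SigmaTwoMeasurable (AlgGen G') (fun μ : RadonProb K => ∫ x, f x ∂μ.measure) := by
  refine sigmaTwoMeasurable_of_lo (h.lo_tilde hf.lo C hC) ?_
  have := h.lo_tilde (hf.comp_cont continuous_neg).lo C (fun x => by simpa using hC x)
  simpa only [integral_neg] using this

/-- Truncation at level `C`. -/
def trunc (C y : ℝ) : ℝ := max (-C) (min C y)

lemma continuous_trunc (C : ℝ) : Continuous (trunc C) := by unfold trunc; fun_prop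

lemma abs_trunc_le {C : ℝ} (hC : 0 ≤ C) (y : ℝ) : |trunc C y| ≤ C := by
  unfold trunc
  rw [abs_le]
  exact ⟨le_max_left _ _, max_le (by linarith) (min_le_left _ _)⟩

lemma trunc_eq {C y : ℝ} (h : |y| ≤ C) : trunc C y = y := by
  unfold trunc
  rw [abs_le] at h
  rw [min_eq_right h.2, max_eq_right h.1]

lemma tendsto_tilde {g : ℕ → K → ℝ} {f : K → ℝ} {C : ℝ} (hC : 0 ≤ C) (μ : RadonProb K)
    (hg : ∀ n, AEMeasurable (g n) μ.measure)
    (h : ∀ x, Tendsto (fun n => g n x) atTop (𝓝 (f x))) :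
    Tendsto (fun n => ∫ x, trunc C (g n x) ∂μ.measure) atTop
      (𝓝 (∫ x, trunc C (f x) ∂μ.measure)) := by
  refine tendsto_integral_of_dominated_convergence (fun _ => C) (fun n => ?_) (integrable_const _)
    (fun n => Filter.Eventually.of_forall fun x => abs_trunc_le hC _)
    (Filter.Eventually.of_forall fun x => ((continuous_trunc C).tendsto _).comp (h x))
  exact ((continuous_trunc C).measurable.comp_aemeasurable (hg n)).aestronglyMeasurable

lemma CoreHyp.up (h : CoreHyp G G') {α : Ordinal.{0}} {f : K → ℝ}
    (hf : FunHier (SigmaTwoMeasurable (AlgGen G)) α f) :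
    (∀ μ : RadonProb K, AEMeasurable f μ.measure) ∧ ∀ C : ℝ, 0 ≤ C →
      FunHier (SigmaTwoMeasurable (AlgGen G')) α
        (fun μ : RadonProb K => ∫ x, trunc C (f x) ∂μ.measure) := by
  induction hf with
  | base f hf =>
    exact ⟨h.aemeas hf.lo, fun C hC => FunHier.base _
      (h.measurable_tilde (hf.comp_cont (continuous_trunc C)) C fun x => abs_trunc_le hC _)⟩
  | lim α β g f h1 h2 _ h4 ih =>
    refine ⟨fun μ => aemeasurable_of_tendsto_metrizable_ae atTop (fun n => (ih n).1 μ)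
      (Filter.Eventually.of_forall h4), fun C hC => ?_⟩
    exact FunHier.lim α β _ _ h1 h2 (fun n => (ih n).2 C hC) fun μ =>
      tendsto_tilde hC μ (fun n => (ih n).1 μ) h4

lemma BaireClass.up {α : Ordinal.{0}} {f : K → ℝ} (hf : BaireClass K ℝ α f) :
    (∀ μ : RadonProb K, AEMeasurable f μ.measure) ∧ ∀ C : ℝ, 0 ≤ C →
      BaireClass (RadonProb K) ℝ α
        (fun μ : RadonProb K => ∫ x, trunc C (f x) ∂μ.measure) := by
  induction hf with
  | base f hf =>
    exact ⟨fun μ => hf.measurable.aemeasurable, fun C hC => BaireClass.base _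
      (continuous_tilde ((continuous_trunc C).comp hf))⟩
  | lim α β g f h2 _ h4 ih =>
    refine ⟨fun μ => aemeasurable_of_tendsto_metrizable_ae atTop (fun n => (ih n).1 μ)
      (Filter.Eventually.of_forall h4), fun C hC => ?_⟩
    exact BaireClass.lim α β _ _ h2 (fun n => (ih n).2 C hC) fun μ =>
      tendsto_tilde hC μ (fun n => (ih n).1 μ) h4

lemma BaireClass.comp {X Y : Type*} [TopologicalSpace X] [TopologicalSpace Y] {φ : X → Y}
    (hφ : Continuous φ) {α : Ordinal.{0}} {f : Y → ℝ} (hf : BaireClass Y ℝ α f) :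
    BaireClass X ℝ α (fun x => f (φ x)) := by
  induction hf with
  | base f hf => exact BaireClass.base _ (hf.comp hφ)
  | lim α β g f h2 _ h4 ih =>
    exact BaireClass.lim α β (fun n x => g n (φ x)) _ h2 ih fun x => h4 _

lemma innerRegular_dirac (x : K) : (Measure.dirac x).InnerRegular := by
  refine ⟨fun A hA r hr => ?_⟩
  by_cases hx : x ∈ A
  · refine ⟨{x}, by simpa using hx, isCompact_singleton, ?_⟩
    refine hr.trans_le ?_
    simp [hx]
  · rw [Measure.dirac_apply' _ hA] at hr
    simp [hx] at hr

/-- The Dirac embedding of `K` into `M¹(K)`. -/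
def diracR (x : K) : RadonProb K := ⟨diracProba x, innerRegular_dirac x⟩

lemma integral_diracR (f : K → ℝ) (x : K) : ∫ y, f y ∂(diracR x).measure = f x :=
  integral_dirac f x

lemma continuous_diracR : Continuous (diracR : K → RadonProb K) :=
  continuous_diracProba.subtype_mk _

end Hier

/-- Let `K` be compact Hausdorff, `f : K → ℝ` bounded and universally
measurable, and `f̃(μ) = ∫ f dμ` on `M¹(K)`. Then, for every countable ordinal `α` in
the appropriate range, `f ∈ Hf_α(K)` iff `f̃ ∈ Hf_α(M¹(K))`, `f ∈ Bof_α(K)` iff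
`f̃ ∈ Bof_α(M¹(K))`, and `f ∈ C_α(K)` iff `f̃ ∈ C_α(M¹(K))`. -/
theorem statement6 {K : Type*} [TopologicalSpace K] [CompactSpace K] [T2Space K]
    [MeasurableSpace K] [BorelSpace K]
    (f : K → ℝ) (hbdd : ∃ C : ℝ, ∀ x, |f x| ≤ C) (hum : UnivMeasurableFn f) :
    (∀ α : Ordinal.{0}, 1 ≤ α → α < omega1 →
      (HfClass K α f ↔
        HfClass (RadonProb K) α (fun μ : RadonProb K => ∫ x, f x ∂(RadonProb.measure μ)))) ∧
    (∀ α : Ordinal.{0}, 1 ≤ α → α < omega1 →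
      (BofClass K α f ↔
        BofClass (RadonProb K) α (fun μ : RadonProb K => ∫ x, f x ∂(RadonProb.measure μ)))) ∧
    (∀ α : Ordinal.{0}, α < omega1 →
      (BaireClass K ℝ α f ↔
        BaireClass (RadonProb K) ℝ α
          (fun μ : RadonProb K => ∫ x, f x ∂(RadonProb.measure μ)))) := by

  obtain ⟨C, hC⟩ := hbdd
  have hC' : ∀ x, |f x| ≤ max C 0 := fun x => (hC x).trans (le_max_left _ _)
  have htr : (fun μ : RadonProb K => ∫ x, trunc (max C 0) (f x) ∂(RadonProb.measure μ)) =
      fun μ : RadonProb K => ∫ x, f x ∂(RadonProb.measure μ) := by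
    funext μ
    simp only [trunc_eq (hC' _)]
  have hd : (fun x : K => ∫ y, f y ∂(diracR x).measure) = f := funext (integral_diracR f)
  refine ⟨fun α _ _ => ⟨fun h => ?_, fun h => ?_⟩, fun α _ _ => ⟨fun h => ?_, fun h => ?_⟩,
    fun α _ => ⟨fun h => ?_, fun h => ?_⟩⟩
  · have := (coreHyp_res.up h).2 _ (le_max_right C 0)
    rwa [htr] at this
  · have := FunHier.comp (G := fun s => Resolvable s) (diracR (K := K))
      (fun s hs => Resolvable.preimage continuous_diracR hs) h
    rwa [hd] at this
  · have := (coreHyp_bos.up h).2 _ (le_max_right C 0)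
    rwa [htr] at this
  · have := FunHier.comp (G := fun s => IsOpen s) (diracR (K := K))
      (fun s hs => IsOpen.preimage continuous_diracR hs) h
    rwa [hd] at this
  · have := h.up.2 _ (le_max_right C 0)
    rwa [htr] at this
  · have := BaireClass.comp continuous_diracR h
    rwa [hd] at this
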